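/- Let A be a homomorphism-homogeneous relational structure such that for every natural number n the age of A contains, up to isomorphism, only finitely many structures of cardinality n. Then A is weakly oligomorphic. -/

import Mathlib

open FirstOrder FirstOrder.Language FirstOrder.Language.Structure CategoryTheory

universe u v w w' w'' w'''

/-- A first-order homomorphism is an embedding if it agrees pointwise with some embedding. -/
def IsHomEmbedding {L : FirstOrder.Language} {M N : Type*} [L.Structure M] [L.Structure N]
    (f : M →[L] N) : Prop :=
  ∃ e : M ↪[L] N, ∀ x, e x = f x

/-- A structure is weakly oligomorphic if for every arity `n` there are only finitely many
relations on `n`-tuples invariant under all endomorphisms. -/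
def WeaklyOligomorphic (L : FirstOrder.Language) (M : Type*) [L.Structure M] : Prop :=
  ∀ n : ℕ, {ρ : Set (Fin n → M) | ∀ f : M →[L] M, ∀ a ∈ ρ, f ∘ a ∈ ρ}.Finite

/-- A structure is homomorphism-homogeneous if every homomorphism from a finite substructure
into the structure extends to an endomorphism. -/
def HomHomogeneous (L : FirstOrder.Language) (M : Type*) [L.Structure M] : Prop :=
  ∀ S : L.Substructure M, (S : Set M).Finite →
    ∀ f : S →[L] M, ∃ g : M →[L] M, ∀ x : S, g (x : M) = f x

/-- A structure is weakly homomorphism-homogeneous if for finite substructures `B ≤ C`, every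
homomorphism from `B` into the structure extends to a homomorphism from `C`. -/
def WeaklyHomHomogeneous (L : FirstOrder.Language) (M : Type*) [L.Structure M] : Prop :=
  ∀ (B C : L.Substructure M) (h : B ≤ C), (C : Set M).Finite →
    ∀ f : B →[L] M, ∃ g : C →[L] M, ∀ x : B, g (Substructure.inclusion h x) = f x

/-- The age of a structure: the class of all finite structures embeddable into it. -/
def Age.{u₁, v₁, w₁, w₂} (L : FirstOrder.Language.{u₁, v₁}) (M : Type w₂) [L.Structure M] :
    Set (Bundled.{w₁} L.Structure) :=
  {N | Finite N ∧ Nonempty (N ↪[L] M)}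

/-- A class of structures projects onto another if every member of the first admits a
homomorphism to some member of the second. -/
def ProjectsOnto (L : FirstOrder.Language.{u, v}) (C D : Set (Bundled.{w} L.Structure)) : Prop :=
  ∀ A ∈ C, ∃ B ∈ D, Nonempty (A →[L] B)

/-- The hereditary property: a class is closed under (isomorphic copies of) substructures of
its members, i.e. closed under embeddability. -/
def HasHP (L : FirstOrder.Language.{u, v}) (C : Set (Bundled.{w} L.Structure)) : Prop :=
  ∀ A ∈ C, ∀ B : Bundled.{w} L.Structure, Nonempty (B ↪[L] A) → B ∈ C

/-- The joint embedding property. -/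
def HasJEP (L : FirstOrder.Language.{u, v}) (C : Set (Bundled.{w} L.Structure)) : Prop :=
  ∀ A ∈ C, ∀ B ∈ C, ∃ D ∈ C, Nonempty (A ↪[L] D) ∧ Nonempty (B ↪[L] D)

/-- The amalgamation property. -/
def HasAP (L : FirstOrder.Language.{u, v}) (C : Set (Bundled.{w} L.Structure)) : Prop :=
  ∀ A ∈ C, ∀ B₁ ∈ C, ∀ B₂ ∈ C, ∀ (f₁ : A ↪[L] B₁) (f₂ : A ↪[L] B₂),
    ∃ D ∈ C, ∃ (g₁ : B₁ ↪[L] D) (g₂ : B₂ ↪[L] D), ∀ a, g₁ (f₁ a) = g₂ (f₂ a)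

/-- The homo-amalgamation property: for every homomorphism `f₁ : A → B₁` and every embedding
`f₂ : A ↪ B₂` within the class there are `D` in the class, an embedding `g₁ : B₁ ↪ D` and a
homomorphism `g₂ : B₂ → D` with `g₁ ∘ f₁ = g₂ ∘ f₂`. -/
def HasHAP (L : FirstOrder.Language.{u, v}) (C : Set (Bundled.{w} L.Structure)) : Prop :=
  ∀ A ∈ C, ∀ B₁ ∈ C, ∀ B₂ ∈ C, ∀ (f₁ : A →[L] B₁) (f₂ : A ↪[L] B₂),
    ∃ D ∈ C, ∃ (g₁ : B₁ ↪[L] D) (g₂ : B₂ →[L] D), ∀ a, g₁ (f₁ a) = g₂ (f₂ a)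

/-- Closure under isomorphism. -/
def IsoClosed (L : FirstOrder.Language.{u, v}) (C : Set (Bundled.{w} L.Structure)) : Prop :=
  ∀ A ∈ C, ∀ B : Bundled.{w} L.Structure, Nonempty (A ≃[L] B) → B ∈ C

/-- A structure is hom-irreducible in a class if every homomorphism from it to a member of
the class is an embedding. -/
def HomIrreducibleIn (L : FirstOrder.Language.{u, v}) (C : Set (Bundled.{w} L.Structure))
    (A : Type*) [L.Structure A] : Prop :=
  ∀ B ∈ C, ∀ f : A →[L] B, IsHomEmbedding f

/-- `CA L M` is the class of all finite structures in the age of `M` that are hom-irreducible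
in the age of `M`. -/
def CA.{u₁, v₁, w₁, w₂} (L : FirstOrder.Language.{u₁, v₁}) (M : Type w₂) [L.Structure M] :
    Set (Bundled.{w₁} L.Structure) :=
  {B | B ∈ Age.{u₁, v₁, w₁, w₂} L M ∧
    HomIrreducibleIn.{u₁, v₁, w₁, w₁} L (Age.{u₁, v₁, w₁, w₂} L M) B}

/-- `M ⪯_h N` : the age of `N` is contained in the age of `M`, and for all finite
substructures `A ≤ B` of `M`, every homomorphism from `A` to `N` extends to `B`. -/
def PrecH.{u₁, v₁, w₁, w₂, w₃} (L : FirstOrder.Language.{u₁, v₁}) (M : Type w₂) (N : Type w₃)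
    [L.Structure M] [L.Structure N] : Prop :=
  Age.{u₁, v₁, w₁, w₃} L N ⊆ Age.{u₁, v₁, w₁, w₂} L M ∧
  ∀ (A B : L.Substructure M) (h : A ≤ B), (B : Set M).Finite →
    ∀ f : A →[L] N, ∃ g : B →[L] N, ∀ x : A, g (Substructure.inclusion h x) = f x

/-- A structure is (ultra)homogeneous if every isomorphism between finite substructures
(i.e. every embedding of a finite substructure into the structure) extends to an
automorphism. -/
def Ultrahomogeneous (L : FirstOrder.Language) (M : Type*) [L.Structure M] : Prop :=
  ∀ S : L.Substructure M, (S : Set M).Finite →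
    ∀ f : S ↪[L] M, ∃ g : M ≃[L] M, ∀ x : S, g (x : M) = f x

/-- A structure is oligomorphic if for every `n` its automorphism group has finitely many
orbits on `n`-tuples. -/
def Oligomorphic (L : FirstOrder.Language) (M : Type*) [L.Structure M] : Prop :=
  ∀ n : ℕ, ∃ S : Set (Fin n → M), S.Finite ∧
    ∀ a : Fin n → M, ∃ b ∈ S, ∃ g : M ≃[L] M, (fun i => g (b i)) = a

/-- A structure is a core if every endomorphism is an embedding. -/
def IsCore (L : FirstOrder.Language) (M : Type*) [L.Structure M] : Prop :=
  ∀ f : M →[L] M, IsHomEmbedding f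

/-- A substructure `C` is a core of `M` if `C` is a core and some endomorphism of `M` has
image contained in `C`. -/
def IsCoreOf (L : FirstOrder.Language) (M : Type*) [L.Structure M]
    (C : L.Substructure M) : Prop :=
  IsCore L C ∧ ∃ f : M →[L] M, ∀ x, f x ∈ C

/-- The constraint satisfaction problem of `M`: the class of all finite structures admitting
a homomorphism to `M`. -/
def CSP.{u₁, v₁, w₁, w₂} (L : FirstOrder.Language.{u₁, v₁}) (M : Type w₂) [L.Structure M] :
    Set (Bundled.{w₁} L.Structure) :=
  {C | Finite C ∧ Nonempty (C →[L] M)}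

/-- `f` is an `n`-ary polymorphism of `M`, i.e. a homomorphism from the `n`-th direct power
of `M` to `M`. -/
def IsPolymorphism (L : FirstOrder.Language) {M : Type*} [L.Structure M] {n : ℕ}
    (f : (Fin n → M) → M) : Prop :=
  ∀ {m : ℕ} (R : L.Relations m) (x : Fin n → Fin m → M),
    (∀ j, RelMap R (x j)) → RelMap R (fun i => f (fun j => x j i))

/-- A finite structure in any universe has an isomorphic copy in any other universe. -/
theorem exists_equiv_bundled_of_finite (L : FirstOrder.Language.{u, v}) (N : Type w')
    [L.Structure N] [Finite N] :
    ∃ B : Bundled.{w} L.Structure, Nonempty (N ≃[L] B) := by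
  let e : N ≃ ULift.{w} (Fin (Nat.card N)) := (Finite.equivFin N).trans Equiv.ulift.symm
  exact ⟨⟨_, e.inducedStructure⟩, ⟨@Equiv.inducedStructureEquiv L N _ _ e⟩⟩

/-- In a homomorphism-homogeneous structure, an endomorphism-invariant relation contains, with a
tuple `a` from a finite substructure, every tuple `b` from a substructure having the same image
as `a` under isomorphisms with a common third structure. -/
theorem HomHomogeneous.mem_of_equiv {L : FirstOrder.Language.{u, v}} {M : Type w'} [L.Structure M]
    (hhh : HomHomogeneous L M) {n : ℕ} {ρ : Set (Fin n → M)}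
    (hρ : ∀ f : M →[L] M, ∀ a ∈ ρ, f ∘ a ∈ ρ) {a b : Fin n → M} (ha : a ∈ ρ)
    {S T : L.Substructure M} (hS : (S : Set M).Finite) (haS : ∀ i, a i ∈ S) (hbT : ∀ i, b i ∈ T)
    {C : Type w} [L.Structure C] (e : S ≃[L] C) (e' : T ≃[L] C)
    (h : ∀ i, e ⟨a i, haS i⟩ = e' ⟨b i, hbT i⟩) : b ∈ ρ := by
  obtain ⟨g, hg⟩ := hhh S hS (T.subtype.toHom.comp (e'.symm.toHom.comp e.toHom))
  have hgab : g ∘ a = b := by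
    funext i
    have := hg ⟨a i, haS i⟩
    simp only [Function.comp_apply]
    rw [this]
    change ((e'.symm (e ⟨a i, haS i⟩) : T) : M) = b i
    rw [h i, FirstOrder.Language.Equiv.symm_apply_apply]
  exact hgab ▸ hρ g a ha

/-- A relational structure whose age has, up to isomorphism, finitely many structures of each
finite cardinality has finitely many isomorphism types of substructures generated by
`n`-tuples. -/
theorem exists_finite_closure_types_of_finite_age (L : FirstOrder.Language.{u, v}) [L.IsRelational]
    (M : Type w') [L.Structure M]
    (hage : ∀ n : ℕ, ∃ S : Set (Bundled.{w} L.Structure), S.Finite ∧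
      ∀ B ∈ Age.{u, v, w, w'} L M, Nat.card B = n → ∃ C ∈ S, Nonempty (B ≃[L] C)) (n : ℕ) :
    ∃ T : Set (Bundled.{w} L.Structure), T.Finite ∧ (∀ C ∈ T, Finite C) ∧
      ∀ a : Fin n → M, ∃ C ∈ T, Nonempty (Substructure.closure L (Set.range a) ≃[L] C) := by
  choose S hS hSage using hage
  refine ⟨{C ∈ ⋃ k ∈ Set.Iic n, S k | Finite C},
    ((Set.finite_Iic n).biUnion fun k _ => hS k).subset fun _ h => h.1, fun _ h => h.2,
    fun a => ?_⟩
  have hcl : (Substructure.closure L (Set.range a) : Set M) = Set.range a :=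
    Substructure.closure_eq_of_isRelational L _
  have hfin : Finite (Substructure.closure L (Set.range a)) := by
    change (Substructure.closure L (Set.range a) : Set M).Finite
    rw [hcl]
    exact Set.finite_range a
  obtain ⟨B, ⟨e⟩⟩ := exists_equiv_bundled_of_finite.{u, v, w, w'} L
    (Substructure.closure L (Set.range a))
  have hBfin : Finite B := Finite.of_equiv _ e.toEquiv
  have hcard : Nat.card B ≤ n := by
    rw [← Nat.card_congr e.toEquiv]
    change Nat.card (Substructure.closure L (Set.range a) : Set M) ≤ n
    rw [hcl]
    simpa using Finite.card_range_le a
  obtain ⟨C, hC, ⟨e'⟩⟩ := hSage _ B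
    ⟨hBfin, ⟨(Substructure.subtype _).comp e.symm.toEmbedding⟩⟩ rfl
  exact ⟨C, ⟨Set.mem_biUnion hcard hC, Finite.of_equiv _ e'.toEquiv⟩, ⟨e'.comp e⟩⟩

/-- If `M` is homomorphism-homogeneous and for every `n` its age contains, up to
isomorphism, only finitely many structures of cardinality `n`, then `M` is weakly
oligomorphic. -/
theorem stmt13 (L : FirstOrder.Language.{u, v}) [L.IsRelational]
    (M : Type w') [L.Structure M]
    (hhh : HomHomogeneous L M)
    (hage : ∀ n : ℕ, ∃ S : Set (Bundled.{w} L.Structure), S.Finite ∧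
      ∀ B ∈ Age.{u, v, w, w'} L M, Nat.card B = n → ∃ C ∈ S, Nonempty (B ≃[L] C)) :
    WeaklyOligomorphic L M := by
  intro n
  obtain ⟨T, hT, hTfin, hcode⟩ := exists_finite_closure_types_of_finite_age L M hage n
  choose C hCT e using hcode
  have hmem (a : Fin n → M) (i : Fin n) : a i ∈ Substructure.closure L (Set.range a) :=
    Substructure.subset_closure ⟨i, rfl⟩
  have : Finite T := hT
  have (X : T) : Finite (X : Bundled.{w} L.Structure) := hTfin X X.2
  let code (a : Fin n → M) : Σ X : T, Fin n → (X : Bundled.{w} L.Structure) :=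
    ⟨⟨C a, hCT a⟩, fun i => (e a).some ⟨a i, hmem a i⟩⟩
  have hmem_of_code {ρ : Set (Fin n → M)} (hρ : ∀ f : M →[L] M, ∀ a ∈ ρ, f ∘ a ∈ ρ)
      {a b : Fin n → M} (ha : a ∈ ρ) (hab : code a = code b) : b ∈ ρ := by
    have key : ∀ (X : T) (t : Fin n → (X : Bundled.{w} L.Structure)), code b = ⟨X, t⟩ →
        ∃ e' : Substructure.closure L (Set.range b) ≃[L] (X : Bundled.{w} L.Structure),
          ∀ i, e' ⟨b i, hmem b i⟩ = t i := by
      rintro X t h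
      cases h
      exact ⟨(e b).some, fun i => rfl⟩
    obtain ⟨e', he'⟩ := key _ _ hab.symm
    have hfin : (Substructure.closure L (Set.range a) : Set M).Finite := by
      rw [Substructure.closure_eq_of_isRelational]
      exact Set.finite_range a
    exact hhh.mem_of_equiv hρ ha hfin (hmem a) (hmem b) (e a).some e' fun i => (he' i).symm
  refine Set.Finite.of_finite_image (f := Set.image code) (Set.toFinite _) ?_
  have hsub {ρ σ : Set (Fin n → M)} (hσ : ∀ f : M →[L] M, ∀ a ∈ σ, f ∘ a ∈ σ)
      (h : code '' ρ = code '' σ) : ρ ⊆ σ := fun a ha => by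
    obtain ⟨b, hb, hba⟩ := h ▸ Set.mem_image_of_mem code ha
    exact hmem_of_code hσ hb hba
  exact fun ρ hρ σ hσ h => (hsub hσ h).antisymm (hsub hρ h.symm)
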